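/- Let α > 0 be real, m ≥ 0 an integer, and let f : [0,1) → ℝ be smooth with compact support contained in (0,1). Let C_m^α denote the Gegenbauer polynomial of degree m and order α, defined by the Rodrigues formula C_m^α(x) = ((-1)^m/(2^m m!)) (Γ(α+1/2)Γ(m+2α)/(Γ(2α)Γ(α+m+1/2))) (1-x^2)^{-α+1/2} (d^m/dx^m)[(1-x^2)^{m+α-1/2}], and set K = (-1)^m Γ(α+1/2)Γ(m+2α)/(2^m m! Γ(2α)Γ(m+α+1/2)). Let D denote (1/t) d/dt. Then for every t ∈ (0,2): ∫_{|1-t|}^{1} u^{2α} f(u) C_m^α((1+u^2-t^2)/(2u)) (1 - ((1+u^2-t^2)/(2u))^2)^{α-1/2} du = (K (-1)^m / 4^{m+α-1/2}) · D^m [ ∫_{|1-t|}^{1} u^{1-m} f(u) ([(1+t)^2-u^2][u^2-(1-t)^2])^{m+α-1/2} du ]. -/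

import Mathlib

/-- The Gegenbauer polynomial `C_m^α` of degree `m` and order `α`, via the Rodrigues
formula
`C_m^α(x) = ((-1)^m/(2^m m!)) (Γ(α+1/2)Γ(m+2α)/(Γ(2α)Γ(α+m+1/2)))
  (1-x²)^{-α+1/2} (d/dx)^m (1-x²)^{m+α-1/2}`. -/
noncomputable def gegenbauer (m : ℕ) (α : ℝ) (x : ℝ) : ℝ :=
  ((-1 : ℝ) ^ m / (2 ^ m * (Nat.factorial m : ℝ))) *
    (Real.Gamma (α + 1 / 2) * Real.Gamma ((m : ℝ) + 2 * α) /
      (Real.Gamma (2 * α) * Real.Gamma (α + (m : ℝ) + 1 / 2))) *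
    (1 - x ^ 2) ^ (-α + 1 / 2) *
    iteratedDeriv m (fun y : ℝ => (1 - y ^ 2) ^ ((m : ℝ) + α - 1 / 2)) x

/-- The differential operator `D = (1/t) d/dt`. -/
noncomputable def Dop (φ : ℝ → ℝ) : ℝ → ℝ := fun t => (1 / t) * deriv φ t

open MeasureTheory Set Polynomial

/-- The polynomial factor `P_k` in `(d/dx)^k (1 - x²)^b = P_k(x) (1 - x²)^(b - k)`. -/
noncomputable def rodriguesPoly (b : ℝ) : ℕ → ℝ[X]
  | 0 => 1
  | k + 1 => (1 - X ^ 2) * derivative (rodriguesPoly b k) -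
      C (2 * (b - k)) * X * rodriguesPoly b k

lemma one_sub_sq_pos {x : ℝ} (hx : x ∈ Ioo (-1 : ℝ) 1) : 0 < 1 - x ^ 2 := by
  nlinarith [hx.1, hx.2]

lemma hasDerivAt_one_sub_sq_rpow (p : ℝ) {x : ℝ} (hx : x ∈ Ioo (-1 : ℝ) 1) :
    HasDerivAt (fun y : ℝ => (1 - y ^ 2) ^ p) (-(2 * p * x) * (1 - x ^ 2) ^ (p - 1)) x := by
  have h := (((hasDerivAt_id x).pow 2).const_sub 1).rpow_const (p := p)
    (Or.inl (one_sub_sq_pos hx).ne')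
  refine h.congr_deriv ?_
  simp only [id, Pi.pow_apply]
  push_cast
  ring

lemma iteratedDeriv_one_sub_sq_rpow (b : ℝ) (k : ℕ) {x : ℝ} (hx : x ∈ Ioo (-1 : ℝ) 1) :
    iteratedDeriv k (fun y : ℝ => (1 - y ^ 2) ^ b) x =
      (rodriguesPoly b k).eval x * (1 - x ^ 2) ^ (b - k) := by
  induction k generalizing x with
  | zero => simp [rodriguesPoly]
  | succ k ih =>
    have hev : iteratedDeriv k (fun y : ℝ => (1 - y ^ 2) ^ b) =ᶠ[nhds x]
        fun y => (rodriguesPoly b k).eval y * (1 - y ^ 2) ^ (b - k) := by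
      filter_upwards [Ioo_mem_nhds hx.1 hx.2] with y hy using ih hy
    have hd := ((rodriguesPoly b k).hasDerivAt x).fun_mul (hasDerivAt_one_sub_sq_rpow (b - k) hx)
    have hp : (1 - x ^ 2) ^ (b - k) = (1 - x ^ 2) ^ (b - k - 1) * (1 - x ^ 2) := by
      rw [← Real.rpow_add_one (one_sub_sq_pos hx).ne']
      ring_nf
    have he : b - ((k + 1 : ℕ) : ℝ) = b - k - 1 := by push_cast; ring
    rw [iteratedDeriv_succ, hev.deriv_eq, HasDerivAt.deriv hd, he, hp]
    simp only [rodriguesPoly, eval_sub, eval_mul, eval_one, eval_pow, eval_X, eval_C]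
    ring

lemma intervalIntegrable_one_sub_sq_rpow {p : ℝ} (hp : -1 < p) :
    IntervalIntegrable (fun s : ℝ => (1 - s ^ 2) ^ p) volume (-1) 1 := by
  have right : IntervalIntegrable (fun s : ℝ => (1 - s ^ 2) ^ p) volume 0 1 := by
    have h1 : IntervalIntegrable (fun s : ℝ => (1 - s) ^ p) volume 0 1 := by
      have h := (intervalIntegral.intervalIntegrable_rpow' hp (a := 1) (b := 0)).comp_sub_left 1
      simpa using h
    have h2 : ContinuousOn (fun s : ℝ => (1 + s) ^ p) (uIcc 0 1) := by
      refine ContinuousOn.rpow_const (by fun_prop) fun s hs => Or.inl ?_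
      rw [uIcc_of_le zero_le_one] at hs
      linarith [hs.1]
    refine (h1.mul_continuousOn h2).congr fun s hs => ?_
    rw [uIoc_of_le zero_le_one] at hs
    rw [← Real.mul_rpow (by linarith [hs.2]) (by linarith [hs.1])]
    ring_nf
  have left : IntervalIntegrable (fun s : ℝ => (1 - s ^ 2) ^ p) volume (-1) 0 := by
    have h := (right.comp_sub_left 0).symm
    simpa using h
  exact left.trans right

/-- The substitution `u² = 1 + t² + 2ts` in the spherical mean integral. -/
lemma integral_eq_integral_of_comp_sq {t : ℝ} (ht : t ∈ Ioo (0 : ℝ) 2) {F G : ℝ → ℝ}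
    (hF : ∀ u ∈ Ioo |1 - t| (1 + t), F u = u / t * G ((u ^ 2 - 1 - t ^ 2) / (2 * t)))
    (hF_one : ∀ u, 1 ≤ u → F u = 0) :
    ∫ u in |1 - t|..1, F u = ∫ s in (-1 : ℝ)..1, G s := by
  obtain ⟨ht0, ht2⟩ := ht
  have habs : |1 - t| < 1 := abs_lt.2 ⟨by linarith, by linarith⟩
  have himage : (fun u : ℝ => (u ^ 2 - 1 - t ^ 2) / (2 * t)) '' Ioo |1 - t| (1 + t) =
      Ioo (-1) 1 := by
    ext s
    constructor
    · rintro ⟨u, ⟨hu1, hu2⟩, rfl⟩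
      have hu0 : 0 < u := (abs_nonneg _).trans_lt hu1
      have h1 : (1 - t) ^ 2 < u ^ 2 := sq_lt_sq.2 (by rwa [abs_of_pos hu0])
      constructor
      · rw [lt_div_iff₀ (by linarith)]
        linarith
      · rw [div_lt_iff₀ (by linarith)]
        nlinarith
    · rintro ⟨hs1, hs2⟩
      have hlow : (1 - t) ^ 2 < 1 + t ^ 2 + 2 * t * s := by nlinarith
      refine ⟨√(1 + t ^ 2 + 2 * t * s), ⟨?_, ?_⟩, ?_⟩
      · rw [← Real.sqrt_sq_eq_abs]
        exact Real.sqrt_lt_sqrt (sq_nonneg _) hlow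
      · rw [Real.sqrt_lt' (by linarith)]
        nlinarith
      · simp only
        rw [Real.sq_sqrt ((sq_nonneg _).trans hlow.le)]
        field_simp
        ring
  have hderiv : ∀ u ∈ Ioo |1 - t| (1 + t),
      HasDerivWithinAt (fun u : ℝ => (u ^ 2 - 1 - t ^ 2) / (2 * t)) (u / t)
        (Ioo |1 - t| (1 + t)) u := by
    intro u _
    have h := ((((hasDerivAt_id u).pow 2).sub_const 1).sub_const (t ^ 2)).div_const (2 * t)
    refine (h.congr_deriv ?_).hasDerivWithinAt
    simp
    field_simp
  have hinj : InjOn (fun u : ℝ => (u ^ 2 - 1 - t ^ 2) / (2 * t)) (Ioo |1 - t| (1 + t)) := by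
    intro u hu v hv huv
    have hu0 : 0 ≤ u := (abs_nonneg _).trans hu.1.le
    have hv0 : 0 ≤ v := (abs_nonneg _).trans hv.1.le
    simp only at huv
    field_simp at huv
    exact (sq_eq_sq₀ hu0 hv0).1 (by linarith)
  have hchange := integral_image_eq_integral_abs_deriv_smul measurableSet_Ioo hderiv hinj G
  rw [himage] at hchange
  rw [intervalIntegral.integral_of_le habs.le, intervalIntegral.integral_of_le (by norm_num),
    integral_Ioc_eq_integral_Ioo (x := (-1 : ℝ)), hchange,
    ← setIntegral_eq_of_subset_of_forall_sdiff_eq_zero measurableSet_Ioc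
      (Ioc_subset_Ioc_right (by linarith : (1 : ℝ) ≤ 1 + t)),
    integral_Ioc_eq_integral_Ioo]
  · refine setIntegral_congr_fun measurableSet_Ioo fun u hu => ?_
    have hu0 : 0 < u := (abs_nonneg _).trans_lt hu.1
    rw [hF u hu, abs_of_pos (by positivity), smul_eq_mul]
  · rintro u ⟨hu, hu'⟩
    exact hF_one u (le_of_not_ge fun h => hu' ⟨hu.1, h⟩)

/-- Differentiation in the radius of a weighted integral of `H (1 + t² + 2ts, 1 + ts)`;
an integration by parts in `s` lowers the exponent of the weight. -/
lemma hasDerivAt_rpow_mul_integral {H : ℝ × ℝ → ℝ} (hH : ContDiff ℝ 1 H) {γ : ℝ} (hγ : 0 < γ)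
    {t : ℝ} (ht : 0 < t) :
    HasDerivAt
      (fun t : ℝ => t ^ (2 * γ + 1) *
        ∫ s in (-1 : ℝ)..1, H (1 + t ^ 2 + 2 * t * s, 1 + t * s) * (1 - s ^ 2) ^ γ)
      (t * (t ^ (2 * γ - 1) * ∫ s in (-1 : ℝ)..1,
        (2 * γ * (1 + t * s) * H (1 + t ^ 2 + 2 * t * s, 1 + t * s) -
          t ^ 2 * (1 - s ^ 2) * fderiv ℝ H (1 + t ^ 2 + 2 * t * s, 1 + t * s) (0, 1)) *
        (1 - s ^ 2) ^ (γ - 1))) t := by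
  set H' := fderiv ℝ H with hH'
  have hcH : Continuous H := hH.continuous
  have hcH' : Continuous H' := hH.continuous_fderiv one_ne_zero
  have hdH : ∀ p, HasFDerivAt H (H' p) p := fun p =>
    (hH.differentiable one_ne_zero p).hasFDerivAt
  have hcw : Continuous fun s : ℝ => (1 - s ^ 2) ^ γ :=
    Continuous.rpow_const (by fun_prop) fun _ => Or.inr hγ.le
  have hAt : ∀ r s : ℝ, HasDerivAt (fun r : ℝ => H (1 + r ^ 2 + 2 * r * s, 1 + r * s))
      (H' (1 + r ^ 2 + 2 * r * s, 1 + r * s) (2 * r + 2 * s, s)) r := by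
    intro r s
    have h1 : HasDerivAt (fun r : ℝ => 1 + r ^ 2 + 2 * r * s) (2 * r + 2 * s) r := by
      refine ((((hasDerivAt_id r).pow 2).const_add 1).add
        (((hasDerivAt_id r).const_mul 2).mul_const s)).congr_deriv ?_
      simp
    have h2 : HasDerivAt (fun r : ℝ => 1 + r * s) s r := by
      simpa using ((hasDerivAt_id r).mul_const s).const_add 1
    exact (hdH _).comp_hasDerivAt r (h1.prodMk h2)
  have hAs : ∀ s : ℝ, HasDerivAt (fun s : ℝ => H (1 + t ^ 2 + 2 * t * s, 1 + t * s))
      (H' (1 + t ^ 2 + 2 * t * s, 1 + t * s) (2 * t, t)) s := by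
    intro s
    have h1 : HasDerivAt (fun s : ℝ => 1 + t ^ 2 + 2 * t * s) (2 * t) s := by
      simpa using ((hasDerivAt_id s).const_mul (2 * t)).const_add (1 + t ^ 2)
    have h2 : HasDerivAt (fun s : ℝ => 1 + t * s) t s := by
      simpa using ((hasDerivAt_id s).const_mul t).const_add 1
    exact (hdH _).comp_hasDerivAt s (h1.prodMk h2)
  set A : ℝ → ℝ := fun s => H (1 + t ^ 2 + 2 * t * s, 1 + t * s) with hA
  set T : ℝ → ℝ := fun s => H' (1 + t ^ 2 + 2 * t * s, 1 + t * s) (2 * t + 2 * s, s) with hT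
  set S : ℝ → ℝ := fun s => H' (1 + t ^ 2 + 2 * t * s, 1 + t * s) (2 * t, t) with hS
  have hcA : Continuous A := by fun_prop
  have hcT : Continuous T := by fun_prop
  have hcS : Continuous S := by fun_prop
  have hint : HasDerivAt
      (fun r : ℝ => ∫ s in (-1 : ℝ)..1, H (1 + r ^ 2 + 2 * r * s, 1 + r * s) * (1 - s ^ 2) ^ γ)
      (∫ s in (-1 : ℝ)..1, T s * (1 - s ^ 2) ^ γ) t := by
    have hcF' : Continuous fun p : ℝ × ℝ =>
        H' (1 + p.1 ^ 2 + 2 * p.1 * p.2, 1 + p.1 * p.2) (2 * p.1 + 2 * p.2, p.2) *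
          (1 - p.2 ^ 2) ^ γ := by
      have : Continuous fun p : ℝ × ℝ => (1 - p.2 ^ 2) ^ γ := hcw.comp continuous_snd
      fun_prop
    obtain ⟨M, hM⟩ := ((isCompact_closedBall t 1).prod
      (isCompact_Icc (a := (-1 : ℝ)) (b := 1))).exists_bound_of_continuousOn hcF'.continuousOn
    refine (intervalIntegral.hasDerivAt_integral_of_dominated_loc_of_deriv_le
      (F' := fun r s => H' (1 + r ^ 2 + 2 * r * s, 1 + r * s) (2 * r + 2 * s, s) *
        (1 - s ^ 2) ^ γ) (bound := fun _ => M)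
      (Metric.closedBall_mem_nhds t one_pos) ?_ ?_ ?_ ?_ intervalIntegrable_const ?_).2
    · refine Filter.Eventually.of_forall fun r => Continuous.aestronglyMeasurable ?_
      fun_prop
    · exact (hcA.mul hcw).intervalIntegrable _ _
    · exact (hcT.mul hcw).aestronglyMeasurable
    · refine Filter.Eventually.of_forall fun s hs r hr => ?_
      rw [uIoc_of_le (by norm_num)] at hs
      exact hM (r, s) ⟨hr, hs.1.le, hs.2⟩
    · exact Filter.Eventually.of_forall fun s _ r _ => (hAt r s).mul_const _
  have hw' : IntervalIntegrable (fun s : ℝ => (1 - s ^ 2) ^ (γ - 1)) volume (-1) 1 :=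
    intervalIntegrable_one_sub_sq_rpow (by linarith)
  have hsucc : ∀ s ∈ Ioo (-1 : ℝ) 1,
      (1 - s ^ 2) ^ γ = (1 - s ^ 2) * (1 - s ^ 2) ^ (γ - 1) := by
    intro s hs
    rw [mul_comm, ← Real.rpow_add_one (one_sub_sq_pos hs).ne']
    ring_nf
  have hparts : ∫ s in (-1 : ℝ)..1, ((A s + (t + s) * S s) * (1 - s ^ 2) -
      2 * γ * s * (t + s) * A s) * (1 - s ^ 2) ^ (γ - 1) = 0 := by
    have hFTC := intervalIntegral.integral_eq_sub_of_hasDerivAt_of_le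
      (f := fun s => (t + s) * A s * (1 - s ^ 2) ^ γ)
      (f' := fun s => ((A s + (t + s) * S s) * (1 - s ^ 2) -
        2 * γ * s * (t + s) * A s) * (1 - s ^ 2) ^ (γ - 1))
      (by norm_num : (-1 : ℝ) ≤ 1) (by fun_prop) ?_ ?_
    · rw [hFTC]
      simp [Real.zero_rpow hγ.ne']
    · intro s hs
      refine ((((hasDerivAt_id s).const_add t).mul (hAs s)).mul
        (hasDerivAt_one_sub_sq_rpow γ hs)).congr_deriv ?_
      simp only [id, Pi.mul_apply, hsucc s hs]
      ring
    · exact hw'.continuousOn_mul (by fun_prop)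
  have hpow0 := Real.hasDerivAt_rpow_const (x := t) (p := 2 * γ + 1) (Or.inl ht.ne')
  refine (hpow0.mul hint).congr_deriv ?_
  have hpow1 : t ^ (2 * γ + 1 - 1) = t * t ^ (2 * γ - 1) := by
    rw [mul_comm t, ← Real.rpow_add_one ht.ne']
    congr 1
    ring
  have hpow2 : t ^ (2 * γ + 1) = t * (t * t ^ (2 * γ - 1)) := by
    rw [← hpow1, mul_comm t, ← Real.rpow_add_one ht.ne']
    congr 1
    ring
  have hAint : IntervalIntegrable (fun s => A s * (1 - s ^ 2) ^ γ) volume (-1) 1 :=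
    (hcA.mul hcw).intervalIntegrable _ _
  have hTint : IntervalIntegrable (fun s => T s * (1 - s ^ 2) ^ γ) volume (-1) 1 :=
    (hcT.mul hcw).intervalIntegrable _ _
  have hPint : IntervalIntegrable (fun s => ((A s + (t + s) * S s) * (1 - s ^ 2) -
      2 * γ * s * (t + s) * A s) * (1 - s ^ 2) ^ (γ - 1)) volume (-1) 1 :=
    hw'.continuousOn_mul (by fun_prop)
  have hsum : (2 * γ + 1) * (∫ s in (-1 : ℝ)..1, A s * (1 - s ^ 2) ^ γ) +
      t * (∫ s in (-1 : ℝ)..1, T s * (1 - s ^ 2) ^ γ) =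
      ∫ s in (-1 : ℝ)..1, (2 * γ * (1 + t * s) * A s - t ^ 2 * (1 - s ^ 2) *
        H' (1 + t ^ 2 + 2 * t * s, 1 + t * s) (0, 1)) * (1 - s ^ 2) ^ (γ - 1) := by
    refine (sub_zero _).symm.trans ((congrArg _ hparts.symm).trans ?_)
    rw [← intervalIntegral.integral_const_mul,
      ← intervalIntegral.integral_const_mul,
      ← intervalIntegral.integral_add (hAint.const_mul _) (hTint.const_mul _),
      ← intervalIntegral.integral_sub ((hAint.const_mul _).add (hTint.const_mul _)) hPint]
    refine intervalIntegral.integral_congr_Ioo_of_le (by norm_num) fun s hs => ?_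
    have hlin : t * T s - (t + s) * S s =
        -t ^ 2 * H' (1 + t ^ 2 + 2 * t * s, 1 + t * s) (0, 1) := by
      simp only [hT, hS, ← smul_eq_mul, ← map_smul, ← map_sub]
      congr 1
      ext <;> simp <;> ring
    rw [hsucc s hs]
    linear_combination (1 - s ^ 2) * (1 - s ^ 2) ^ (γ - 1) * hlin
  rw [← hsum, hpow1, hpow2]
  ring

/-- A function of `(v, w) = (u², w)` that is homogeneous apart from the radial factor `f u`. -/
noncomputable def radialProfile (f : ℝ → ℝ) (n : ℕ) (P : ℝ[X]) (p : ℝ × ℝ) : ℝ :=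
  f √p.1 * (√p.1)⁻¹ ^ n * P.eval (p.2 * (√p.1)⁻¹)

lemma contDiff_radialProfile {f : ℝ → ℝ} (hf : ContDiff ℝ 1 f) (h0 : (0 : ℝ) ∉ tsupport f)
    (n : ℕ) (P : ℝ[X]) : ContDiff ℝ 1 (radialProfile f n P) := by
  rw [contDiff_iff_contDiffAt]
  rintro ⟨v, w⟩
  rcases le_or_gt v 0 with hv | hv
  · have hlim : Filter.Tendsto (fun p : ℝ × ℝ => √p.1) (nhds (v, w)) (nhds 0) := by
      have h : Continuous fun p : ℝ × ℝ => √p.1 := by fun_prop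
      simpa [Real.sqrt_eq_zero_of_nonpos hv] using h.tendsto (v, w)
    refine (contDiffAt_const (c := (0 : ℝ))).congr_of_eventuallyEq ?_
    filter_upwards [hlim.eventually (notMem_tsupport_iff_eventuallyEq.1 h0)] with p hp
    simp [radialProfile, show f √p.1 = 0 from hp]
  · have hsqrt : ContDiffAt ℝ 1 (fun p : ℝ × ℝ => √p.1) (v, w) :=
      contDiffAt_fst.sqrt hv.ne'
    have hinv : ContDiffAt ℝ 1 (fun p : ℝ × ℝ => (√p.1)⁻¹) (v, w) :=
      hsqrt.inv (Real.sqrt_pos.2 hv).ne'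
    have hP : ContDiff ℝ 1 fun x : ℝ => P.eval x := by
      simpa using P.contDiff_aeval (𝕜 := ℝ) 1
    exact ((hf.contDiffAt.comp (v, w) hsqrt).mul (hinv.pow n)).mul
      (hP.contDiffAt.comp (v, w) (contDiffAt_snd.mul hinv))

lemma fderiv_radialProfile_apply {f : ℝ → ℝ} (hf : ContDiff ℝ 1 f) (h0 : (0 : ℝ) ∉ tsupport f)
    (n : ℕ) (P : ℝ[X]) (v w : ℝ) :
    fderiv ℝ (radialProfile f n P) (v, w) (0, 1) =
      radialProfile f (n + 1) (derivative P) (v, w) := by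
  have hH := ((contDiff_radialProfile hf h0 n P).differentiable one_ne_zero (v, w)).hasFDerivAt
  have h1 := hH.comp_hasDerivAt w ((hasDerivAt_const w v).prodMk (hasDerivAt_id w))
  have h2 := (((P.hasDerivAt (w * (√v)⁻¹)).comp w
    ((hasDerivAt_id w).mul_const (√v)⁻¹))).const_mul (f √v * (√v)⁻¹ ^ n)
  refine (h1.unique h2).trans ?_
  simp only [radialProfile]
  ring

/-- The action of the lowering step of `hasDerivAt_rpow_mul_integral` on radial profiles. -/
lemma radialProfile_step {f : ℝ → ℝ} (hf : ContDiff ℝ 1 f) (h0 : (0 : ℝ) ∉ tsupport f)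
    (n k : ℕ) (b : ℝ) {v w : ℝ} (hv : 0 < v) :
    2 * (b - k) * w * radialProfile f (n + 1) (rodriguesPoly b k) (v, w) -
      (v - w ^ 2) * fderiv ℝ (radialProfile f (n + 1) (rodriguesPoly b k)) (v, w) (0, 1) =
    -radialProfile f n (rodriguesPoly b (k + 1)) (v, w) := by
  rw [fderiv_radialProfile_apply hf h0]
  have hu : 0 < √v := Real.sqrt_pos.2 hv
  obtain ⟨u, hu_def⟩ : ∃ u, u = √v := ⟨_, rfl⟩
  have hvu : v = u ^ 2 := by rw [hu_def, Real.sq_sqrt hv.le]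
  rw [← hu_def] at hu
  simp only [radialProfile, ← hu_def, rodriguesPoly, eval_sub, eval_mul, eval_one, eval_pow,
    eval_X, eval_C]
  rw [hvu]
  simp only [inv_pow]
  field_simp
  ring

lemma eq_zero_of_one_le {f : ℝ → ℝ} (hsupp : tsupport f ⊆ Ioo 0 1) {u : ℝ} (hu : 1 ≤ u) :
    f u = 0 :=
  image_eq_zero_of_notMem_tsupport fun h => hu.not_gt (hsupp h).2

/-- Iterates of `D = (1/t) d/dt` on the radial-type integral in the variable `s`. -/
lemma iterate_Dop_eq {f : ℝ → ℝ} (hf : ContDiff ℝ 1 f) (h0 : (0 : ℝ) ∉ tsupport f)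
    {m : ℕ} {b : ℝ} (hb : (m : ℝ) - 1 < b) {c : ℝ} {Φ : ℝ → ℝ}
    (hΦ : ∀ t ∈ Ioo (0 : ℝ) 2, Φ t = c * (t ^ (2 * b + 1) * ∫ s in (-1 : ℝ)..1,
      radialProfile f m 1 (1 + t ^ 2 + 2 * t * s, 1 + t * s) * (1 - s ^ 2) ^ b))
    {k : ℕ} (hk : k ≤ m) {t : ℝ} (ht : t ∈ Ioo (0 : ℝ) 2) :
    Dop^[k] Φ t = (-1) ^ k * c * (t ^ (2 * (b - k) + 1) * ∫ s in (-1 : ℝ)..1,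
      radialProfile f (m - k) (rodriguesPoly b k) (1 + t ^ 2 + 2 * t * s, 1 + t * s) *
        (1 - s ^ 2) ^ (b - k)) := by
  induction k generalizing t with
  | zero => simpa [rodriguesPoly] using hΦ t ht
  | succ k ih =>
    have hkm : (k : ℝ) + 1 ≤ m := by exact_mod_cast hk
    have hev : Dop^[k] Φ =ᶠ[nhds t] fun t => (-1) ^ k * c * (t ^ (2 * (b - k) + 1) *
        ∫ s in (-1 : ℝ)..1, radialProfile f (m - k) (rodriguesPoly b k)
          (1 + t ^ 2 + 2 * t * s, 1 + t * s) * (1 - s ^ 2) ^ (b - k)) := by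
      filter_upwards [Ioo_mem_nhds ht.1 ht.2] with r hr using ih (by omega) hr
    have hd := (hasDerivAt_rpow_mul_integral (contDiff_radialProfile hf h0 (m - k)
      (rodriguesPoly b k)) (γ := b - k) (by linarith) ht.1).const_mul ((-1) ^ k * c)
    have hn : m - k = m - (k + 1) + 1 := by omega
    have hstep : ∫ s in (-1 : ℝ)..1, (2 * (b - k) * (1 + t * s) *
          radialProfile f (m - k) (rodriguesPoly b k) (1 + t ^ 2 + 2 * t * s, 1 + t * s) -
          t ^ 2 * (1 - s ^ 2) * fderiv ℝ (radialProfile f (m - k) (rodriguesPoly b k))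
            (1 + t ^ 2 + 2 * t * s, 1 + t * s) (0, 1)) * (1 - s ^ 2) ^ (b - k - 1) =
        -∫ s in (-1 : ℝ)..1, radialProfile f (m - (k + 1)) (rodriguesPoly b (k + 1))
          (1 + t ^ 2 + 2 * t * s, 1 + t * s) * (1 - s ^ 2) ^ (b - k - 1) := by
      rw [← intervalIntegral.integral_neg]
      refine intervalIntegral.integral_congr_Ioo_of_le (by norm_num) fun s hs => ?_
      have hv : 0 < 1 + t ^ 2 + 2 * t * s := by nlinarith [one_sub_sq_pos hs, sq_nonneg (t + s)]
      rw [hn, ← neg_mul, ← radialProfile_step hf h0 _ k b hv]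
      ring
    have he : b - ((k + 1 : ℕ) : ℝ) = b - k - 1 := by push_cast; ring
    rw [Function.iterate_succ_apply', Dop, hev.deriv_eq, hd.deriv, hstep, he]
    have hexp : 2 * (b - k - 1) + 1 = 2 * (b - k) - 1 := by ring
    rw [hexp]
    have := ht.1.ne'
    field_simp
    ring

/-- **Reduction of the `m`-th spherical-harmonic component of the spherical mean
transform to a `D^m`-derivative** (the identity following from \eqref{Eq49.3}).
For real `α > 0`, integer `m ≥ 0`, `f` smooth with compact support in `(0,1)`,
`K = (-1)^m Γ(α+1/2)Γ(m+2α)/(2^m m! Γ(2α)Γ(m+α+1/2))`, and every `t ∈ (0,2)`: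
`∫_{|1-t|}^1 u^{2α} f(u) C_m^α((1+u²-t²)/(2u)) (1-((1+u²-t²)/(2u))²)^{α-1/2} du
  = (K(-1)^m/4^{m+α-1/2}) D^m [∫_{|1-t|}^1 u^{1-m} f(u)
      ([(1+t)²-u²][u²-(1-t)²])^{m+α-1/2} du](t)`. -/
theorem smt_component_as_Dm_derivative
    (α : ℝ) (hα : 0 < α) (m : ℕ)
    (f : ℝ → ℝ) (hf : ContDiff ℝ (⊤ : ℕ∞) f)
    (hcpt : HasCompactSupport f) (hsupp : tsupport f ⊆ Set.Ioo 0 1)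
    (K : ℝ)
    (hK : K = (-1 : ℝ) ^ m * Real.Gamma (α + 1 / 2) * Real.Gamma ((m : ℝ) + 2 * α) /
      (2 ^ m * (Nat.factorial m : ℝ) * Real.Gamma (2 * α) *
        Real.Gamma ((m : ℝ) + α + 1 / 2)))
    (Φ : ℝ → ℝ)
    (hΦ : ∀ t : ℝ, Φ t =
      ∫ u in |1 - t|..1,
        u ^ (1 - (m : ℤ)) * f u *
          ((((1 + t) ^ 2 - u ^ 2) * (u ^ 2 - (1 - t) ^ 2)) ^ ((m : ℝ) + α - 1 / 2))) :
    ∀ t ∈ Set.Ioo (0 : ℝ) 2,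
      (∫ u in |1 - t|..1,
          u ^ (2 * α) * f u * gegenbauer m α ((1 + u ^ 2 - t ^ 2) / (2 * u)) *
            ((1 - ((1 + u ^ 2 - t ^ 2) / (2 * u)) ^ 2) ^ (α - 1 / 2)))
        = K * (-1 : ℝ) ^ m / (4 : ℝ) ^ ((m : ℝ) + α - 1 / 2) * Dop^[m] Φ t := by
  have hf1 : ContDiff ℝ 1 f := hf.of_le (by exact_mod_cast le_top)
  have h0 : (0 : ℝ) ∉ tsupport f := fun h => (hsupp h).1.false
  set b : ℝ := (m : ℝ) + α - 1 / 2 with hb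
  have hone_sub : ∀ t u : ℝ, 0 < t → 0 < u →
      1 - ((1 + u ^ 2 - t ^ 2) / (2 * u)) ^ 2 =
        t ^ 2 * (1 - ((u ^ 2 - 1 - t ^ 2) / (2 * t)) ^ 2) / u ^ 2 := by
    intro t u ht hu
    field_simp
    ring
  have hmem : ∀ t u : ℝ, 0 < t → u ∈ Ioo |1 - t| (1 + t) →
      0 < 1 - ((u ^ 2 - 1 - t ^ 2) / (2 * t)) ^ 2 := by
    intro t u ht hu
    have hu0 : 0 < u := (abs_nonneg _).trans_lt hu.1
    have h1 : (1 - t) ^ 2 < u ^ 2 := sq_lt_sq.2 (by rw [abs_of_pos hu0]; exact hu.1)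
    have h2 : u ^ 2 < (1 + t) ^ 2 := by nlinarith [hu.2]
    refine one_sub_sq_pos ⟨?_, ?_⟩
    · rw [lt_div_iff₀ (by linarith)]
      linarith
    · rw [div_lt_iff₀ (by linarith)]
      linarith
  have hprofile : ∀ (n : ℕ) (P : ℝ[X]) (t u : ℝ), 0 < t → 0 < u →
      radialProfile f n P (1 + t ^ 2 + 2 * t * ((u ^ 2 - 1 - t ^ 2) / (2 * t)),
        1 + t * ((u ^ 2 - 1 - t ^ 2) / (2 * t))) =
      f u * u⁻¹ ^ n * P.eval ((1 + u ^ 2 - t ^ 2) / (2 * u)) := by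
    intro n P t u ht hu
    have hv : 1 + t ^ 2 + 2 * t * ((u ^ 2 - 1 - t ^ 2) / (2 * t)) = u ^ 2 := by
      field_simp
      ring
    have hx : (1 + t * ((u ^ 2 - 1 - t ^ 2) / (2 * t))) * u⁻¹ =
        (1 + u ^ 2 - t ^ 2) / (2 * u) := by
      field_simp
      ring
    simp only [radialProfile]
    rw [hv, Real.sqrt_sq hu.le, hx]
  have hΦ' : ∀ t ∈ Ioo (0 : ℝ) 2, Φ t = 4 ^ b * (t ^ (2 * b + 1) * ∫ s in (-1 : ℝ)..1,
      radialProfile f m 1 (1 + t ^ 2 + 2 * t * s, 1 + t * s) * (1 - s ^ 2) ^ b) := by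
    intro t ht
    rw [hΦ, ← mul_assoc, ← intervalIntegral.integral_const_mul]
    refine integral_eq_integral_of_comp_sq ht (fun u hu => ?_) fun u hu => by
      simp [eq_zero_of_one_le hsupp hu]
    have ht0 := ht.1
    have hu0 : 0 < u := (abs_nonneg _).trans_lt hu.1
    have hs := hmem t u ht0 hu
    have hQ : ((1 + t) ^ 2 - u ^ 2) * (u ^ 2 - (1 - t) ^ 2) =
        4 * (t ^ 2 * (1 - ((u ^ 2 - 1 - t ^ 2) / (2 * t)) ^ 2)) := by
      field_simp
      ring
    rw [hprofile m 1 t u ht0 hu0, hQ, Real.mul_rpow (by norm_num) (by positivity),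
      Real.mul_rpow (by positivity) hs.le, ← Real.rpow_natCast_mul ht0.le,
      Real.rpow_add_one ht0.ne', zpow_sub₀ hu0.ne', zpow_one, zpow_natCast, eval_one, inv_pow]
    push_cast
    field_simp
  intro t ht
  have ht0 := ht.1
  have hbm : b - m = α - 1 / 2 := by rw [hb]; ring
  rw [iterate_Dop_eq hf1 h0 (by linarith) hΦ' le_rfl ht, hbm, Nat.sub_self]
  have hsign : ((-1 : ℝ) ^ m) * (-1) ^ m = 1 := by rw [← mul_pow]; simp
  have h4 : (4 : ℝ) ^ b ≠ 0 := (Real.rpow_pos_of_pos (by norm_num) b).ne'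
  have hcancel : ∀ I : ℝ, K * (-1) ^ m / 4 ^ b *
      ((-1) ^ m * 4 ^ b * (t ^ (2 * (α - 1 / 2) + 1) * I)) =
      K * t ^ (2 * α) * I := by
    intro I
    rw [show 2 * (α - 1 / 2) + 1 = 2 * α by ring]
    have hregroup : K * (-1) ^ m / 4 ^ b * ((-1) ^ m * 4 ^ b * (t ^ (2 * α) * I)) =
        K * ((-1) ^ m * (-1) ^ m) * (4 ^ b / 4 ^ b) * t ^ (2 * α) * I := by ring
    rw [hregroup, hsign, div_self h4, mul_one, mul_one]
  rw [hcancel, ← intervalIntegral.integral_const_mul]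
  refine integral_eq_integral_of_comp_sq ht (fun u hu => ?_) fun u hu => by
    simp [eq_zero_of_one_le hsupp hu]
  have hu0 : 0 < u := (abs_nonneg _).trans_lt hu.1
  have hs := hmem t u ht0 hu
  have hx := hone_sub t u ht0 hu0
  have hxpos : 0 < 1 - ((1 + u ^ 2 - t ^ 2) / (2 * u)) ^ 2 := by
    rw [hx]
    positivity
  have hxmem : (1 + u ^ 2 - t ^ 2) / (2 * u) ∈ Ioo (-1 : ℝ) 1 := by
    rw [mem_Ioo, ← abs_lt, ← sq_lt_one_iff_abs_lt_one]
    linarith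
  have hgegenbauer : gegenbauer m α ((1 + u ^ 2 - t ^ 2) / (2 * u)) *
      (1 - ((1 + u ^ 2 - t ^ 2) / (2 * u)) ^ 2) ^ (α - 1 / 2) =
      K * ((rodriguesPoly b m).eval ((1 + u ^ 2 - t ^ 2) / (2 * u)) *
        (1 - ((1 + u ^ 2 - t ^ 2) / (2 * u)) ^ 2) ^ (α - 1 / 2)) := by
    have hinv : (1 - ((1 + u ^ 2 - t ^ 2) / (2 * u)) ^ 2) ^ (-α + 1 / 2) *
        (1 - ((1 + u ^ 2 - t ^ 2) / (2 * u)) ^ 2) ^ (α - 1 / 2) = 1 := by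
      rw [← Real.rpow_add hxpos]
      ring_nf
      exact Real.rpow_zero _
    rw [gegenbauer, ← hb, iteratedDeriv_one_sub_sq_rpow b m hxmem, hbm, hK,
      show α + (m : ℝ) + 1 / 2 = (m : ℝ) + α + 1 / 2 by ring]
    generalize (1 - ((1 + u ^ 2 - t ^ 2) / (2 * u)) ^ 2) ^ (-α + 1 / 2) = y at hinv ⊢
    generalize (1 - ((1 + u ^ 2 - t ^ 2) / (2 * u)) ^ 2) ^ (α - 1 / 2) = z at hinv ⊢
    rw [div_mul_div_comm]
    linear_combination ((-1 : ℝ) ^ m * (Real.Gamma (α + 1 / 2) * Real.Gamma ((m : ℝ) + 2 * α)) /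
      (2 ^ m * (Nat.factorial m : ℝ) * (Real.Gamma (2 * α) *
        Real.Gamma ((m : ℝ) + α + 1 / 2)))) *
      (rodriguesPoly b m).eval ((1 + u ^ 2 - t ^ 2) / (2 * u)) * z * hinv
  rw [mul_assoc, hgegenbauer, hprofile 0 _ t u ht0 hu0, hx,
    Real.div_rpow (by positivity) (by positivity), Real.mul_rpow (by positivity) hs.le,
    ← Real.rpow_natCast_mul ht0.le, ← Real.rpow_natCast_mul hu0.le]
  have hexp : ∀ r : ℝ, 0 < r → r ^ (2 * α) = r ^ (((2 : ℕ) : ℝ) * (α - 1 / 2)) * r := by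
    intro r hr
    rw [← Real.rpow_add_one hr.ne']
    congr 1
    push_cast
    ring
  rw [hexp u hu0, hexp t ht0]
  have hpu : u ^ (((2 : ℕ) : ℝ) * (α - 1 / 2)) ≠ 0 := (Real.rpow_pos_of_pos hu0 _).ne'
  field_simp
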